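/- On a finite-dimensional pseudo-Riemannian hom-Lie algebra (g, [·,·], φ, ⟨,⟩) with φ an isomorphism, there exists a unique bilinear product · on g satisfying [u,v] = u·v − v·u and ⟨u·v, φ(w)⟩ = −⟨φ(v), u·w⟩; it is determined by the Koszul formula 2⟨u·v, φ(w)⟩ = ⟨[u,v], φ(w)⟩ + ⟨[w,v], φ(u)⟩ + ⟨[w,u], φ(v)⟩. -/

import Mathlib

/-- A trilinear form on a finite-dimensional space `V` is represented, through a pairing with
trivial left kernel, by a bilinear product on `V`. -/
theorem exists_product_of_separatingLeft {K V : Type*} [Field K] [AddCommGroup V] [Module K V]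
    [FiniteDimensional K V] (C : V →ₗ[K] V →ₗ[K] K) (hC : C.SeparatingLeft)
    (T : V →ₗ[K] V →ₗ[K] Module.Dual K V) :
    ∃ m : V →ₗ[K] V →ₗ[K] V, ∀ u v w : V, C (m u v) w = T u v w := by
  have hker : LinearMap.ker C = ⊥ := LinearMap.separatingLeft_iff_ker_eq_bot.mp hC
  let e : V ≃ₗ[K] Module.Dual K V :=
    LinearEquiv.ofInjectiveOfFinrankEq C (LinearMap.ker_eq_bot.mp hker)
      Subspace.dual_finrank_eq.symm
  refine ⟨T.compr₂ e.symm.toLinearMap, fun u v w => ?_⟩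
  exact LinearMap.congr_fun (e.apply_symm_apply (T u v)) w

/-- Half of the right-hand side of the Koszul formula, as a trilinear form. -/
noncomputable def koszulForm {g : Type*} [AddCommGroup g] [Module ℝ g]
    (br : g →ₗ[ℝ] g →ₗ[ℝ] g) (φ : g →ₗ[ℝ] g) (B : g →ₗ[ℝ] g →ₗ[ℝ] ℝ) :
    g →ₗ[ℝ] g →ₗ[ℝ] Module.Dual ℝ g :=
  LinearMap.mk₂ ℝ
    (fun u v => (1 / 2 : ℝ) • ((B (br u v)).comp φ + (B.flip (φ u)).comp (br.flip v)
      + (B.flip (φ v)).comp (br.flip u)))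
    (by intros; ext; simp; ring)
    (by intros; ext; simp; ring)
    (by intros; ext; simp; ring)
    (by intros; ext; simp; ring)

theorem two_mul_koszulForm_apply {g : Type*} [AddCommGroup g] [Module ℝ g]
    (br : g →ₗ[ℝ] g →ₗ[ℝ] g) (φ : g →ₗ[ℝ] g) (B : g →ₗ[ℝ] g →ₗ[ℝ] ℝ) (u v w : g) :
    2 * koszulForm br φ B u v w
      = B (br u v) (φ w) + B (br w v) (φ u) + B (br w u) (φ v) := by
  simp [koszulForm]
  ring

/-- A torsion-free product compatible with the metric satisfies the Koszul formula. -/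
theorem koszul_formula {g : Type*} [AddCommGroup g] [Module ℝ g]
    {br : g →ₗ[ℝ] g →ₗ[ℝ] g} {φ : g →ₗ[ℝ] g} {B : g →ₗ[ℝ] g →ₗ[ℝ] ℝ}
    (hBsymm : ∀ u v : g, B u v = B v u) {m : g →ₗ[ℝ] g →ₗ[ℝ] g}
    (htorsion : ∀ u v : g, br u v = m u v - m v u)
    (hmetric : ∀ u v w : g, B (m u v) (φ w) = - B (φ v) (m u w)) (u v w : g) :
    2 * B (m u v) (φ w)
      = B (br u v) (φ w) + B (br w v) (φ u) + B (br w u) (φ v) := by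
  have hskew : ∀ x y z : g, B (m x y) (φ z) = - B (m x z) (φ y) := fun x y z => by
    rw [hmetric, hBsymm]
  simp only [htorsion, map_sub, LinearMap.sub_apply]
  linarith [hskew u v w, hskew v u w, hskew w u v]

/-- existence and uniqueness of the hom-Levi-Civita product, and the
Koszul formula determining it. -/
theorem homLeviCivita_exists_unique {g : Type*} [AddCommGroup g] [Module ℝ g]
    [FiniteDimensional ℝ g]
    (br : g →ₗ[ℝ] g →ₗ[ℝ] g) (φ : g →ₗ[ℝ] g)
    (hanti : ∀ u v : g, br u v = - br v u)
    (hφ : ∀ u v : g, φ (br u v) = br (φ u) (φ v))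
    (hjac : ∀ u v w : g, br (φ u) (br v w) + br (φ v) (br w u) + br (φ w) (br u v) = 0)
    (hφbij : Function.Bijective φ)
    (B : g →ₗ[ℝ] g →ₗ[ℝ] ℝ)
    (hBsymm : ∀ u v : g, B u v = B v u)
    (hBnd : ∀ u : g, (∀ v : g, B u v = 0) → u = 0)
    (hBφ : ∀ u v : g, B (φ u) (φ v) = B u v) :
    (∃! m : g →ₗ[ℝ] g →ₗ[ℝ] g,
      (∀ u v : g, br u v = m u v - m v u) ∧
      (∀ u v w : g, B (m u v) (φ w) = - B (φ v) (m u w))) ∧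
    (∀ m : g →ₗ[ℝ] g →ₗ[ℝ] g,
      ((∀ u v : g, br u v = m u v - m v u) ∧
       (∀ u v w : g, B (m u v) (φ w) = - B (φ v) (m u w))) →
      ∀ u v w : g,
        2 * B (m u v) (φ w)
          = B (br u v) (φ w) + B (br w v) (φ u) + B (br w u) (φ v)) := by
  have hC : (B.compl₂ φ).SeparatingLeft := fun x hx => hBnd x fun y => by
    obtain ⟨w, rfl⟩ := hφbij.surjective y
    exact hx w
  have hext : ∀ x y : g, (∀ w, B x (φ w) = B y (φ w)) → x = y := fun x y h =>
    sub_eq_zero.mp (hC _ fun w => by simp [h w])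
  have hkoszul := fun (m : g →ₗ[ℝ] g →ₗ[ℝ] g)
      (hm : (∀ u v : g, br u v = m u v - m v u) ∧
        (∀ u v w : g, B (m u v) (φ w) = - B (φ v) (m u w))) =>
    koszul_formula hBsymm hm.1 hm.2
  refine ⟨?_, hkoszul⟩
  obtain ⟨m, hm⟩ := exists_product_of_separatingLeft _ hC (koszulForm br φ B)
  have hm' : ∀ u v w : g, 2 * B (m u v) (φ w)
      = B (br u v) (φ w) + B (br w v) (φ u) + B (br w u) (φ v) := fun u v w => by
    rw [← two_mul_koszulForm_apply, ← hm, LinearMap.compl₂_apply]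
  have hneg : ∀ x y z : g, B (br x y) z = - B (br y x) z := fun x y z => by
    rw [hanti x y, map_neg, LinearMap.neg_apply]
  refine ⟨m, ⟨fun u v => hext _ _ fun w => ?_, fun u v w => ?_⟩, fun n hn => ?_⟩
  · simp only [map_sub, LinearMap.sub_apply]
    linarith [hm' u v w, hm' v u w, hneg u v (φ w)]
  · rw [hBsymm (φ v)]
    linarith [hm' u v w, hm' u w v, hneg u v (φ w), hneg w v (φ u), hneg w u (φ v)]
  · refine LinearMap.ext₂ fun u v => hext _ _ fun w => ?_
    linarith [hm' u v w, hkoszul n hn u v w]
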